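/- arXiv:1801.01394 — 2 statements merged into one kernel-verified Lean document; each statement's English description precedes it below -/
import Mathlib

section
/- If λ ≥ ‖Xᵀε‖∞, then any LASSO solution β̃(λ) satisfies ‖Xβ̃(λ) − Xβ*‖₂²/n ≤ 4λ‖β*‖₁/n. -/
open Matrix BigOperators Finset

/-- The ℓ1-norm of a vector. -/
noncomputable def norm1 {m : ℕ} (v : Fin m → ℝ) : ℝ := ∑ i, |v i|

/-- The squared ℓ2-norm of a vector. -/
noncomputable def norm2sq {m : ℕ} (v : Fin m → ℝ) : ℝ := ∑ i, (v i) ^ 2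

/-- The ℓ2-norm of a vector. -/
noncomputable def norm2 {m : ℕ} (v : Fin m → ℝ) : ℝ := Real.sqrt (∑ i, (v i) ^ 2)

/-- The ℓ∞ (sup) norm of a vector (the Pi norm on `Fin m → ℝ`). -/
noncomputable def normInf {m : ℕ} (v : Fin m → ℝ) : ℝ := ‖v‖

/-- `b` is a LASSO solution with tuning parameter `lam`:
a minimizer over `β ∈ ℝ^p` of `‖Y − Xβ‖₂² + 2 lam ‖β‖₁`. -/
def IsLassoSol {n p : ℕ} (X : Matrix (Fin n) (Fin p) ℝ) (Y : Fin n → ℝ) (lam : ℝ)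
    (b : Fin p → ℝ) : Prop :=
  ∀ β : Fin p → ℝ,
    norm2sq (Y - X.mulVec b) + 2 * lam * norm1 b ≤
      norm2sq (Y - X.mulVec β) + 2 * lam * norm1 β

/-- Hölder's inequality for the pairing of the sup norm with the ℓ1-norm. -/
theorem dotProduct_le_normInf_mul_norm1 {m : ℕ} (u v : Fin m → ℝ) :
    u ⬝ᵥ v ≤ normInf u * norm1 v := by
  rw [dotProduct, norm1, Finset.mul_sum]
  refine Finset.sum_le_sum fun i _ => (le_abs_self _).trans ?_
  rw [abs_mul]
  exact mul_le_mul_of_nonneg_right (norm_le_pi_norm u i) (abs_nonneg _)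

theorem norm1_nonneg {m : ℕ} (v : Fin m → ℝ) : 0 ≤ norm1 v :=
  Finset.sum_nonneg fun _ _ => abs_nonneg _

theorem norm1_sub_le {m : ℕ} (u v : Fin m → ℝ) : norm1 (u - v) ≤ norm1 u + norm1 v := by
  rw [norm1, norm1, norm1, ← Finset.sum_add_distrib]
  exact Finset.sum_le_sum fun i _ => abs_sub (u i) (v i)

theorem norm2sq_sub {m : ℕ} (u v : Fin m → ℝ) :
    norm2sq (u - v) = norm2sq u - 2 * (u ⬝ᵥ v) + norm2sq v := by
  simp only [norm2sq, dotProduct, Finset.mul_sum, ← Finset.sum_sub_distrib,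
    ← Finset.sum_add_distrib, Pi.sub_apply]
  exact Finset.sum_congr rfl fun i _ => by ring

/-- Lemma 2 (slow-rate bound for the LASSO): if `λ ≥ ‖Xᵀε‖∞`, then any LASSO solution
`β̃(λ)` satisfies `‖Xβ̃(λ) − Xβ*‖₂²/n ≤ 4λ‖β*‖₁/n`. -/
theorem lasso_slow_rate {n p : ℕ} (X : Matrix (Fin n) (Fin p) ℝ)
    (βs : Fin p → ℝ) (ε Y : Fin n → ℝ) (hY : Y = X.mulVec βs + ε)
    (lam : ℝ) (hlam0 : 0 < lam)
    (hlam : lam ≥ normInf (Xᵀ.mulVec ε))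
    (b : Fin p → ℝ) (hb : IsLassoSol X Y lam b) :
    norm2sq (X.mulVec b - X.mulVec βs) / n ≤ 4 * lam * norm1 βs / n := by
  have hmin := hb βs
  have hres : Y - X.mulVec b = ε - X.mulVec (b - βs) := by
    rw [hY, Matrix.mulVec_sub]
    abel
  have hnoise : Y - X.mulVec βs = ε := by
    rw [hY]
    abel
  rw [hres, hnoise, norm2sq_sub] at hmin
  have hdual : ε ⬝ᵥ X.mulVec (b - βs) = Xᵀ.mulVec ε ⬝ᵥ (b - βs) := by
    rw [Matrix.dotProduct_mulVec, Matrix.mulVec_transpose]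
  have hcross : ε ⬝ᵥ X.mulVec (b - βs) ≤ lam * (norm1 b + norm1 βs) := by
    rw [hdual]
    calc Xᵀ.mulVec ε ⬝ᵥ (b - βs)
        ≤ normInf (Xᵀ.mulVec ε) * norm1 (b - βs) := dotProduct_le_normInf_mul_norm1 _ _
      _ ≤ lam * norm1 (b - βs) := mul_le_mul_of_nonneg_right hlam (norm1_nonneg _)
      _ ≤ lam * (norm1 b + norm1 βs) := mul_le_mul_of_nonneg_left (norm1_sub_le _ _) hlam0.le
  rw [← Matrix.mulVec_sub]
  refine div_le_div_of_nonneg_right ?_ n.cast_nonneg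
  linarith
end

section
/- Suppose ‖XᵀXβ*‖∞ ≥ (1 + 2/c)‖Xᵀε‖∞ (Assumption 2), û ≤ ‖XᵀY‖∞, and 2‖Xᵀε‖∞ ≤ cû. Then any TREX solution β̂ satisfies ‖Xβ̂ − Xβ*‖₂² ≤ (2‖Xᵀε‖∞ + û)‖β*‖₁. -/
open Matrix BigOperators Finset

/-- The TREX objective with constant `c`. -/
noncomputable def trexObj {n p : ℕ} (X : Matrix (Fin n) (Fin p) ℝ) (Y : Fin n → ℝ)
    (c : ℝ) (β : Fin p → ℝ) : ℝ :=
  norm2sq (Y - X.mulVec β) / (c * normInf (Xᵀ.mulVec (Y - X.mulVec β))) + norm1 β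

/-- `b` is a TREX solution: a minimizer of the TREX objective over all `β` with
`Xᵀ(Y − Xβ) ≠ 0` (in particular `û := ‖Xᵀ(Y − Xb)‖∞` is nonzero). -/
def IsTrexSol {n p : ℕ} (X : Matrix (Fin n) (Fin p) ℝ) (Y : Fin n → ℝ) (c : ℝ)
    (b : Fin p → ℝ) : Prop :=
  Xᵀ.mulVec (Y - X.mulVec b) ≠ 0 ∧
    ∀ β : Fin p → ℝ, Xᵀ.mulVec (Y - X.mulVec β) ≠ 0 →
      trexObj X Y c b ≤ trexObj X Y c β

theorem norm2sq_eq_dotProduct {m : ℕ} (v : Fin m → ℝ) : norm2sq v = v ⬝ᵥ v := by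
  simp [norm2sq, dotProduct, sq]

theorem norm1_smul {m : ℕ} (a : ℝ) (v : Fin m → ℝ) : norm1 (a • v) = |a| * norm1 v := by
  simp [norm1, abs_mul, Finset.mul_sum]

theorem abs_dotProduct_le_normInf_mul_norm1 {m : ℕ} (v w : Fin m → ℝ) :
    |v ⬝ᵥ w| ≤ normInf v * norm1 w := by
  rw [dotProduct, norm1, Finset.mul_sum]
  refine (Finset.abs_sum_le_sum_abs _ _).trans (Finset.sum_le_sum fun i _ => ?_)
  rw [abs_mul]
  exact mul_le_mul_of_nonneg_right (norm_le_pi_norm v i) (abs_nonneg _)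

theorem abs_dotProduct_mulVec_le {n p : ℕ} (X : Matrix (Fin n) (Fin p) ℝ)
    (v : Fin n → ℝ) (b : Fin p → ℝ) :
    |v ⬝ᵥ X.mulVec b| ≤ normInf (Xᵀ.mulVec v) * norm1 b := by
  rw [dotProduct_mulVec, ← mulVec_transpose]
  exact abs_dotProduct_le_normInf_mul_norm1 _ _

/-- A TREX solution with residual correlation `u` minimizes the Lasso-type objective
`‖Y − Xβ‖₂² + c u ‖β‖₁` among all `β` whose residual correlation is at least `u`. -/
theorem IsTrexSol.lasso_le {n p : ℕ} {X : Matrix (Fin n) (Fin p) ℝ} {Y : Fin n → ℝ} {c : ℝ}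
    {b : Fin p → ℝ} (h : IsTrexSol X Y c b) (hc : 0 < c) (β : Fin p → ℝ)
    (hβ : normInf (Xᵀ.mulVec (Y - X.mulVec b)) ≤ normInf (Xᵀ.mulVec (Y - X.mulVec β))) :
    norm2sq (Y - X.mulVec b) + c * normInf (Xᵀ.mulVec (Y - X.mulVec b)) * norm1 b ≤
      norm2sq (Y - X.mulVec β) + c * normInf (Xᵀ.mulVec (Y - X.mulVec b)) * norm1 β := by
  have hu : 0 < normInf (Xᵀ.mulVec (Y - X.mulVec b)) := norm_pos_iff.mpr h.1
  have hobj := h.2 β (norm_pos_iff.mp (hu.trans_le hβ))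
  unfold trexObj at hobj
  set u := normInf (Xᵀ.mulVec (Y - X.mulVec b))
  have hcu : 0 < c * u := mul_pos hc hu
  have hN : 0 ≤ norm2sq (Y - X.mulVec β) := Finset.sum_nonneg fun _ _ => sq_nonneg _
  have hmono := div_le_div_of_nonneg_left hN hcu (mul_le_mul_of_nonneg_left hβ hc.le)
  have hle := mul_le_mul_of_nonneg_left
    (hobj.trans (add_le_add_left hmono (norm1 β))) hcu.le
  rwa [mul_add, mul_add, mul_div_cancel₀ _ hcu.ne', mul_div_cancel₀ _ hcu.ne'] at hle

/-- On the segment from `0` to a TREX solution `b` there is a point `α • b` whose residual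
correlation is at most that of `b` and at which the comparison of Lasso-type objectives, divided
by `1 - α`, holds (also in the limiting case `α = 1`). -/
theorem IsTrexSol.exists_scaling {n p : ℕ} {X : Matrix (Fin n) (Fin p) ℝ} {Y : Fin n → ℝ}
    {c : ℝ} {b : Fin p → ℝ} (h : IsTrexSol X Y c b) (hc : 0 < c)
    (h0 : normInf (Xᵀ.mulVec (Y - X.mulVec b)) ≤ normInf (Xᵀ.mulVec Y)) :
    ∃ α : ℝ, 0 ≤ α ∧ α ≤ 1 ∧
      normInf (Xᵀ.mulVec (Y - α • X.mulVec b)) ≤ normInf (Xᵀ.mulVec (Y - X.mulVec b)) ∧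
      (1 + α) * (X.mulVec b ⬝ᵥ X.mulVec b) +
          c * normInf (Xᵀ.mulVec (Y - X.mulVec b)) * norm1 b ≤
        2 * (Y ⬝ᵥ X.mulVec b) := by
  have hlasso := h.lasso_le hc
  set u := normInf (Xᵀ.mulVec (Y - X.mulVec b)) with hu
  set g := X.mulVec b with hg
  have hfeas : ∀ α : ℝ, 0 ≤ α → α < 1 → u ≤ normInf (Xᵀ.mulVec (Y - α • g)) →
      (1 + α) * (g ⬝ᵥ g) + c * u * norm1 b ≤ 2 * (Y ⬝ᵥ g) := by
    intro α hα hα1 hle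
    have hcmp := hlasso (α • b) (by rwa [mulVec_smul])
    rw [mulVec_smul, ← hg, norm1_smul, abs_of_nonneg hα, norm2sq_eq_dotProduct,
      norm2sq_eq_dotProduct] at hcmp
    simp only [sub_dotProduct, dotProduct_sub, smul_dotProduct, dotProduct_smul,
      smul_eq_mul, dotProduct_comm g Y] at hcmp
    refine le_of_mul_le_mul_left ?_ (sub_pos.mpr hα1)
    linarith
  by_cases hex : ∃ α : ℝ, 0 ≤ α ∧ α < 1 ∧ normInf (Xᵀ.mulVec (Y - α • g)) = u
  · obtain ⟨α, hα, hα1, heq⟩ := hex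
    exact ⟨α, hα, hα1.le, heq.le, hfeas α hα hα1 heq.ge⟩
  have hcont : Continuous fun α : ℝ => normInf (Xᵀ.mulVec (Y - α • g)) := by
    unfold normInf
    fun_prop
  have hall : ∀ α : ℝ, 0 ≤ α → α < 1 → u ≤ normInf (Xᵀ.mulVec (Y - α • g)) := by
    intro α hα hα1
    by_contra! hlt
    obtain ⟨t, ht, hteq⟩ := intermediate_value_Icc' hα hcont.continuousOn
      ⟨hlt.le, by simpa using h0⟩
    exact hex ⟨t, ht.1, ht.2.trans_lt hα1, hteq⟩
  refine ⟨1, zero_le_one, le_rfl, by rw [one_smul], ?_⟩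
  have hlim : Filter.Tendsto (fun α : ℝ => (1 + α) * (g ⬝ᵥ g) + c * u * norm1 b)
      (nhdsWithin 1 (Set.Iio 1)) (nhds ((1 + 1) * (g ⬝ᵥ g) + c * u * norm1 b)) :=
    (Continuous.tendsto (by fun_prop) 1).mono_left nhdsWithin_le_nhds
  refine le_of_tendsto hlim ?_
  filter_upwards [Ioo_mem_nhdsLT (zero_lt_one (α := ℝ))] with α hα
  exact hfeas α hα.1.le hα.2 (hall α hα.1.le hα.2)

/-- Case 1 of the slow-rate bound for the TREX: under Assumption 2
(`‖XᵀXβ*‖∞ ≥ (1 + 2/c)‖Xᵀε‖∞`), `û ≤ ‖XᵀY‖∞`, and `2‖Xᵀε‖∞ ≤ cû`, any TREX solution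
`β̂` satisfies `‖Xβ̂ − Xβ*‖₂² ≤ (2‖Xᵀε‖∞ + û)‖β*‖₁`. -/
theorem trex_slow_rate_case1 {n p : ℕ} (X : Matrix (Fin n) (Fin p) ℝ)
    (βs : Fin p → ℝ) (ε Y : Fin n → ℝ) (hY : Y = X.mulVec βs + ε)
    (c : ℝ) (hc : 0 < c) (hc2 : c < 2)
    (hA2 : normInf (Xᵀ.mulVec (X.mulVec βs)) ≥ (1 + 2 / c) * normInf (Xᵀ.mulVec ε))
    (bT : Fin p → ℝ) (hbT : IsTrexSol X Y c bT)
    (u : ℝ) (hu : u = normInf (Xᵀ.mulVec (Y - X.mulVec bT)))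
    (huY : u ≤ normInf (Xᵀ.mulVec Y))
    (hcase : 2 * normInf (Xᵀ.mulVec ε) ≤ c * u) :
    norm2sq (X.mulVec bT - X.mulVec βs) ≤
      (2 * normInf (Xᵀ.mulVec ε) + u) * norm1 βs := by
  obtain ⟨α, hα, hα1, hle, hopt⟩ := hbT.exists_scaling hc (hu ▸ huY)
  rw [← hu] at hle hopt
  set f := X.mulVec βs
  have hgε := (le_abs_self _).trans (abs_dotProduct_mulVec_le X ε bT)
  have hfε := (neg_le_abs _).trans (abs_dotProduct_mulVec_le X ε βs)
  have hres := (le_abs_self _).trans (abs_dotProduct_mulVec_le X (Y - α • X.mulVec bT) βs)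
  set g := X.mulVec bT
  have hresu := hres.trans (mul_le_mul_of_nonneg_right hle (norm1_nonneg βs))
  have hcw := mul_le_mul_of_nonneg_right hcase (norm1_nonneg bT)
  have he : 0 ≤ normInf (Xᵀ.mulVec ε) * norm1 βs :=
    mul_nonneg (norm_nonneg _) (norm1_nonneg βs)
  have hgg : 0 ≤ g ⬝ᵥ g := by
    rw [← norm2sq_eq_dotProduct]
    exact Finset.sum_nonneg fun _ _ => sq_nonneg _
  rw [hY] at hopt hresu
  change (f + ε - α • g) ⬝ᵥ f ≤ _ at hresu
  change ε ⬝ᵥ g ≤ _ at hgε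
  change -(ε ⬝ᵥ f) ≤ _ at hfε
  rw [norm2sq_eq_dotProduct]
  simp only [sub_dotProduct, dotProduct_sub, add_dotProduct, smul_dotProduct,
    smul_eq_mul, dotProduct_comm g f] at hopt hresu ⊢
  have hfg : (1 + α) * (g ⬝ᵥ g) ≤ 2 * (f ⬝ᵥ g) := by linarith
  have hgf : g ⬝ᵥ g ≤ (2 - α) * (f ⬝ᵥ g) := by
    nlinarith [mul_le_mul_of_nonneg_left hfg (by linarith : 0 ≤ 2 - α),
      mul_nonneg (mul_nonneg hα (sub_nonneg.mpr hα1)) hgg]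
  linarith
end
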